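/- Let G be a planar graph on n vertices and P a cloud partition of G with clouds of size at most ⌈c log n⌉. Then the structure-maintaining minor F induced by P satisfies |V(F)| = O(n / log n) and |E(F)| = O(|V(F)|). -/

import Mathlib

/-- `H` is a minor of `G`: there is a family of nonempty, pairwise disjoint,
connected branch sets, with an edge of `G` between the branch sets of any
two adjacent vertices of `H`. -/
def SimpleGraph.IsMinorOf {α β : Type*} (H : SimpleGraph β) (G : SimpleGraph α) : Prop :=
  ∃ f : β → Set α,
    (∀ b, (f b).Nonempty) ∧
    (∀ b b', b ≠ b' → Disjoint (f b) (f b')) ∧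
    (∀ b, (G.induce (f b)).Connected) ∧
    (∀ b b', H.Adj b b' → ∃ u ∈ f b, ∃ v ∈ f b', G.Adj u v)

/-- A graph is planar iff it has neither a `K₅` nor a `K₃,₃` minor (Wagner's theorem). -/
def SimpleGraph.IsPlanar {α : Type*} (G : SimpleGraph α) : Prop :=
  ¬ (completeGraph (Fin 5)).IsMinorOf G ∧
  ¬ (completeBipartiteGraph (Fin 3) (Fin 3)).IsMinorOf G

/-- Two clouds are adjacent if they are distinct and joined by an edge of `G`. -/
def CloudAdj {V : Type*} (G : SimpleGraph V) (p q : Set V) : Prop :=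
  p ≠ q ∧ ∃ u ∈ p, ∃ v ∈ q, G.Adj u v

/-- `P` is a cloud partition of `G` with cloud-size bound `k`: a partition of the vertex
set into nonempty connected parts of size at most `k` such that no two small parts
(size `< k`) are adjacent. -/
structure IsCloudPartition {V : Type*} (G : SimpleGraph V) (P : Set (Set V)) (k : ℕ) :
    Prop where
  nonempty : ∀ p ∈ P, p.Nonempty
  disjoint : ∀ p ∈ P, ∀ q ∈ P, p ≠ q → Disjoint p q
  cover : ⋃₀ P = Set.univ
  connected : ∀ p ∈ P, (G.induce p).Connected
  size : ∀ p ∈ P, p.ncard ≤ k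
  no_small_adj : ∀ p ∈ P, ∀ q ∈ P, p.ncard < k → q.ncard < k → ¬ CloudAdj G p q

/-- `F` (with cloud assignment `𝒞`) is the structure-maintaining minor of `G` induced by
the cloud partition `P` with size bound `k`: the clouds are distributed among the nodes
of `F`, a node containing a big cloud contains only that cloud, all clouds of a node
have the same neighboring clouds, the grouping of small clouds by their neighborhoods is
maximal, and nodes are adjacent iff they contain adjacent clouds. -/
structure IsSMM {V ι : Type*} (G : SimpleGraph V) (P : Set (Set V)) (k : ℕ)
    (F : SimpleGraph ι) (𝒞 : ι → Set (Set V)) : Prop where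
  subset : ∀ u, 𝒞 u ⊆ P
  nonempty : ∀ u, (𝒞 u).Nonempty
  disjoint : ∀ u v, u ≠ v → Disjoint (𝒞 u) (𝒞 v)
  cover : ∀ p ∈ P, ∃ u, p ∈ 𝒞 u
  adj : ∀ u v, F.Adj u v ↔ u ≠ v ∧ ∃ p ∈ 𝒞 u, ∃ q ∈ 𝒞 v, CloudAdj G p q
  big_single : ∀ u, ∀ p ∈ 𝒞 u, p.ncard = k → 𝒞 u = {p}
  same_nbrs : ∀ u, ∀ p ∈ 𝒞 u, ∀ q ∈ 𝒞 u,
    {r | r ∈ P ∧ CloudAdj G p r} = {r | r ∈ P ∧ CloudAdj G q r}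
  grouped : ∀ u v, ∀ p ∈ 𝒞 u, ∀ q ∈ 𝒞 v, p.ncard < k → q.ncard < k →
    {r | r ∈ P ∧ CloudAdj G p r} = {r | r ∈ P ∧ CloudAdj G q r} → u = v

open Finset in
/-- Removing a vertex `v` from `S` lowers the degree sum of `G[S]` by twice the degree of `v`. -/
theorem SimpleGraph.sum_card_adj_erase {α : Type*} [DecidableEq α] (G : SimpleGraph α)
    [DecidableRel G.Adj] (S : Finset α) {v : α} (hv : v ∈ S) :
    ∑ x ∈ S, #{w ∈ S | G.Adj x w} =
      ∑ x ∈ S.erase v, #{w ∈ S.erase v | G.Adj x w} + 2 * #{w ∈ S | G.Adj v w} := by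
  have h1 : ∀ x ∈ S.erase v, #{w ∈ S | G.Adj x w} =
      #{w ∈ S.erase v | G.Adj x w} + if G.Adj v x then 1 else 0 := by
    intro x hx
    rw [← Finset.insert_erase hv, Finset.filter_insert]
    by_cases h : G.Adj v x
    · simp [h, h.symm]
    · have h' : ¬ G.Adj x v := fun h' => h h'.symm
      simp [h, h']
  rw [← Finset.sum_erase_add _ _ hv, Finset.sum_congr rfl h1, Finset.sum_add_distrib,
    ← Finset.card_filter]
  have h2 : ({w ∈ S.erase v | G.Adj v w} : Finset α) = {w ∈ S | G.Adj v w} := by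
    ext w
    simp only [Finset.mem_filter, Finset.mem_erase]
    exact ⟨fun h => ⟨h.1.2, h.2⟩, fun h => ⟨⟨h.2.ne', h.1⟩, h.2⟩⟩
  rw [h2]
  ring

/-- The set `S` contains the branch sets of a `K_m` minor of `G`. -/
def SimpleGraph.HasCliqueMinorIn {α : Type*} (G : SimpleGraph α) (m : ℕ) (S : Set α) : Prop :=
  ∃ f : Fin m → Set α, (∀ i, f i ⊆ S) ∧ (∀ i, (G.induce (f i)).Connected) ∧
    ∀ i j, i ≠ j → Disjoint (f i) (f j) ∧ ∃ u ∈ f i, ∃ v ∈ f j, G.Adj u v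

theorem SimpleGraph.connected_induce_singleton {α : Type*} (G : SimpleGraph α) (v : α) :
    (G.induce {v}).Connected :=
  ⟨SimpleGraph.Preconnected.of_subsingleton⟩

theorem SimpleGraph.HasCliqueMinorIn.mono {α : Type*} {G : SimpleGraph α} {m : ℕ} {S T : Set α}
    (h : G.HasCliqueMinorIn m S) (hST : S ⊆ T) : G.HasCliqueMinorIn m T := by
  obtain ⟨f, hf, h⟩ := h
  exact ⟨f, fun i => (hf i).trans hST, h⟩

/-- A connected set `U` adjacent to every vertex of a disjoint set `N` extends a clique minor
in `N` by one branch set. -/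
theorem SimpleGraph.HasCliqueMinorIn.succ {α : Type*} {G : SimpleGraph α} {m : ℕ} {U N : Set α}
    (h : G.HasCliqueMinorIn m N) (hU : (G.induce U).Connected) (hUN : Disjoint U N)
    (hadj : ∀ v ∈ N, ∃ u ∈ U, G.Adj u v) : G.HasCliqueMinorIn (m + 1) (U ∪ N) := by
  obtain ⟨f, hfN, hconn, hf⟩ := h
  have key : ∀ i, Disjoint U (f i) ∧ ∃ u ∈ U, ∃ v ∈ f i, G.Adj u v := by
    intro i
    obtain ⟨v, hv⟩ := (hconn i).nonempty
    obtain ⟨u, hu, huv⟩ := hadj v (hfN i hv)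
    exact ⟨hUN.mono_right (hfN i), u, hu, v, hv, huv⟩
  refine ⟨Fin.cons U f, ?_, ?_, ?_⟩
  · refine Fin.cases ?_ fun i => ?_
    · simp
    · simpa using (hfN i).trans Set.subset_union_right
  · refine Fin.cases ?_ fun i => ?_
    · exact hU
    · exact hconn i
  · refine Fin.cases (Fin.cases (fun h => (h rfl).elim) fun j _ => ?_) fun i =>
      Fin.cases (fun _ => ?_) fun j hij => ?_
    · simpa using key j
    · obtain ⟨hd, u, hu, v, hv, huv⟩ := key i
      exact ⟨by simpa using hd.symm, v, by simpa using hv, u, by simpa using hu, huv.symm⟩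
    · simpa using hf i j fun h => hij (congrArg _ h)

open Finset in
/-- **Mader's theorem**: average degree at least `2 ^ r` forces a `K_{r+2}` minor. -/
theorem SimpleGraph.hasCliqueMinorIn_of_le_sum_card_adj {α : Type*} [DecidableEq α]
    (G : SimpleGraph α) [DecidableRel G.Adj] (r : ℕ) (S : Finset α) (hS : S.Nonempty)
    (h : 2 ^ r * #S ≤ ∑ x ∈ S, #{w ∈ S | G.Adj x w}) : G.HasCliqueMinorIn (r + 2) S := by
  induction r generalizing S with
  | zero =>
    have hpos : 0 < ∑ x ∈ S, #{w ∈ S | G.Adj x w} := by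
      have := hS.card_pos
      omega
    obtain ⟨x, hx, hx'⟩ := Finset.exists_ne_zero_of_sum_ne_zero hpos.ne'
    obtain ⟨y, hy⟩ := Finset.card_ne_zero.mp hx'
    rw [Finset.mem_filter] at hy
    refine ⟨![{x}, {y}], ?_, ?_, ?_⟩
    · simp [Fin.forall_fin_two, hx, hy.1]
    · simp [Fin.forall_fin_two]
    · simp [Fin.forall_fin_two, hy.2, hy.2.symm, hy.2.ne, hy.2.ne']
  | succ r ihr =>
    induction S using Finset.strongInduction with
    | H S ihS =>
    let N : Finset α → Finset α := fun W => {w ∈ W | ∃ u ∈ S \ W, G.Adj u w}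
    let good : Finset α → Prop := fun W => W ⊂ S ∧ (G.induce (↑(S \ W) : Set α)).Connected ∧
      2 ^ (r + 1) * (#W + 1) ≤ ∑ x ∈ W, #{w ∈ W | G.Adj x w} + 2 * #(N W)
    have hne : ∃ W, good W := by
      obtain ⟨v, hv⟩ := hS
      refine ⟨S.erase v, Finset.erase_ssubset hv, ?_, ?_⟩
      · rw [Finset.sdiff_erase hv, Finset.sdiff_self, insert_empty_eq, Finset.coe_singleton]
        exact G.connected_induce_singleton v
      · have hN : N (S.erase v) = {w ∈ S | G.Adj v w} := by
          ext w
          simp only [N, Finset.sdiff_erase hv, Finset.sdiff_self, insert_empty_eq,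
            Finset.mem_filter, Finset.mem_erase, Finset.mem_singleton, exists_eq_left]
          exact ⟨fun h => ⟨h.1.2, h.2⟩, fun h => ⟨⟨h.2.ne', h.1⟩, h.2⟩⟩
        rw [hN, ← G.sum_card_adj_erase S hv, Finset.card_erase_add_one hv]
        exact h
    obtain ⟨W, ⟨hWS, hconn, hW⟩, hmin⟩ := WellFounded.has_min
      (wellFounded_lt (α := Finset α)) {W | good W} hne
    rcases (N W).eq_empty_or_nonempty with hN | hN
    · rw [hN, Finset.card_empty, mul_zero, add_zero] at hW
      have hWne : W.Nonempty := by
        rw [Finset.nonempty_iff_ne_empty]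
        rintro rfl
        simp at hW
      exact (ihS W hWS hWne (le_trans (by gcongr; omega) hW)).mono
        (Finset.coe_subset.mpr hWS.subset)
    · have hdeg : ∀ v ∈ N W, 2 ^ r ≤ #{w ∈ N W | G.Adj v w} := by
        intro v hv
        by_contra hlt
        obtain ⟨hvW, u, hu, huv⟩ : v ∈ W ∧ ∃ u ∈ S \ W, G.Adj u v := by simpa [N] using hv
        have hsd : S \ W.erase v = insert v (S \ W) := by
          rw [Finset.sdiff_erase (hWS.subset hvW)]
        have hcup : (N W).erase v ∪ {w ∈ W | G.Adj v w} = N (W.erase v) := by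
          ext w
          simp only [N, hsd, Finset.mem_union, Finset.mem_erase, Finset.mem_filter,
            Finset.exists_mem_insert]
          have : G.Adj v w → w ≠ v := fun h => h.ne'
          generalize (∃ u ∈ S \ W, G.Adj u w) = E
          tauto
        have hcap : (N W).erase v ∩ {w ∈ W | G.Adj v w} = {w ∈ N W | G.Adj v w} := by
          ext w
          simp only [N, Finset.mem_inter, Finset.mem_erase, Finset.mem_filter]
          have : G.Adj v w → w ≠ v := fun h => h.ne'
          tauto
        have hcard := Finset.card_union_add_card_inter ((N W).erase v) {w ∈ W | G.Adj v w}
        rw [hcup, hcap] at hcard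
        have hNe := Finset.card_erase_add_one hv
        have hWe := Finset.card_erase_add_one hvW
        have hsum := G.sum_card_adj_erase W hvW
        refine hmin (W.erase v) ⟨(Finset.erase_ssubset hvW).trans hWS, ?_, ?_⟩
          (Finset.erase_ssubset hvW)
        · rw [hsd, Finset.coe_insert, Set.insert_eq, Set.union_comm]
          exact SimpleGraph.connected_induce_union hconn.preconnected
            (G.connected_induce_singleton v).preconnected (Finset.mem_coe.mpr hu) rfl huv
        · rw [hWe]
          rw [pow_succ] at hW ⊢
          have : 2 ^ r * 2 * (#W + 1) = 2 ^ r * 2 * #W + 2 ^ r * 2 := by ring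
          omega
      have hrec := ihr (N W) hN <| by
        rw [mul_comm, ← smul_eq_mul]
        exact Finset.card_nsmul_le_sum _ _ _ hdeg
      have hNW : N W ⊆ W := Finset.filter_subset _ _
      refine (hrec.succ hconn ?_ ?_).mono ?_
      · exact Finset.disjoint_coe.mpr (Finset.sdiff_disjoint.mono_right hNW)
      · intro v hv
        simpa using (Finset.mem_filter.mp (Finset.mem_coe.mp hv)).2
      · rw [← Finset.coe_union, Finset.coe_subset]
        exact Finset.union_subset Finset.sdiff_subset (hNW.trans hWS.subset)

theorem SimpleGraph.HasCliqueMinorIn.isMinorOf {α : Type*} {G : SimpleGraph α} {m : ℕ}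
    {S : Set α} (h : G.HasCliqueMinorIn m S) : (completeGraph (Fin m)).IsMinorOf G := by
  obtain ⟨f, -, hconn, hf⟩ := h
  exact ⟨f, fun i => Set.nonempty_coe_sort.mp (hconn i).nonempty, fun i j hij => (hf i j hij).1,
    hconn, fun i j hij => (hf i j hij).2⟩

open Finset in
/-- A `K₅`-minor-free graph has linearly many nonempty cliques. -/
theorem SimpleGraph.card_cliques_le {α : Type*} (G : SimpleGraph α)
    (hG : ¬ (completeGraph (Fin 5)).IsMinorOf G) (S : Finset α) (𝒯 : Finset (Finset α))
    (h𝒯 : ∀ T ∈ 𝒯, T ⊆ S ∧ T.Nonempty ∧ G.IsClique (T : Set α)) : #𝒯 ≤ 128 * #S := by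
  classical
  induction S using Finset.strongInduction generalizing 𝒯 with
  | H S ih =>
  rcases S.eq_empty_or_nonempty with rfl | hS
  · have hempty : 𝒯 = ∅ := Finset.eq_empty_of_forall_notMem fun T hT =>
      (h𝒯 T hT).2.1.ne_empty (Finset.subset_empty.mp (h𝒯 T hT).1)
    simp [hempty]
  obtain ⟨v, hv, hdeg⟩ : ∃ v ∈ S, #{w ∈ S | G.Adj v w} ≤ 7 := by
    by_contra! hlt
    refine hG (G.hasCliqueMinorIn_of_le_sum_card_adj 3 S hS ?_).isMinorOf
    rw [mul_comm, ← smul_eq_mul]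
    exact Finset.card_nsmul_le_sum _ _ _ fun x hx => hlt x hx
  have h1 : #{T ∈ 𝒯 | v ∈ T} ≤ 2 ^ 7 := by
    have hsub : {T ∈ 𝒯 | v ∈ T} ⊆
        ({w ∈ S | G.Adj v w} : Finset α).powerset.image (insert v) := by
      intro T hT
      obtain ⟨hT, hvT⟩ := Finset.mem_filter.mp hT
      refine Finset.mem_image.mpr ⟨T.erase v, ?_, Finset.insert_erase hvT⟩
      rw [Finset.mem_powerset]
      intro w hw
      obtain ⟨hwv, hwT⟩ := Finset.mem_erase.mp hw
      exact Finset.mem_filter.mpr ⟨(h𝒯 T hT).1 hwT, (h𝒯 T hT).2.2 hvT hwT hwv.symm⟩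
    refine (Finset.card_le_card hsub).trans (Finset.card_image_le.trans ?_)
    rw [Finset.card_powerset]
    exact Nat.pow_le_pow_right (by norm_num) hdeg
  have h2 : #{T ∈ 𝒯 | v ∉ T} ≤ 128 * #(S.erase v) := by
    refine ih _ (Finset.erase_ssubset hv) _ fun T hT => ?_
    obtain ⟨hT, hvT⟩ := Finset.mem_filter.mp hT
    exact ⟨Finset.subset_erase.mpr ⟨(h𝒯 T hT).1, hvT⟩, (h𝒯 T hT).2⟩
  have h3 := Finset.card_erase_add_one hv
  have h4 := Finset.card_filter_add_card_filter_not (s := 𝒯) (v ∈ ·)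
  omega

/-- The union of connected branch sets indexed by a connected set of vertices is connected. -/
theorem SimpleGraph.connected_induce_biUnion {α β : Type*} {G : SimpleGraph α} {H : SimpleGraph β}
    {f : β → Set α} (hconn : ∀ b, (G.induce (f b)).Connected)
    (hadj : ∀ b b', H.Adj b b' → ∃ u ∈ f b, ∃ v ∈ f b', G.Adj u v) {s : Set β}
    (hs : (H.induce s).Connected) : (G.induce (⋃ b ∈ s, f b)).Connected := by
  have hsub : ∀ b ∈ s, f b ⊆ ⋃ b ∈ s, f b := fun b hb => Set.subset_biUnion_of_mem hb
  have hlocal : ∀ b (hb : b ∈ s) x (hx : x ∈ f b) y (hy : y ∈ f b),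
      (G.induce (⋃ b ∈ s, f b)).Reachable ⟨x, hsub b hb hx⟩ ⟨y, hsub b hb hy⟩ := fun b hb x hx y hy =>
    ((hconn b).preconnected ⟨x, hx⟩ ⟨y, hy⟩).map (SimpleGraph.induceHomOfLE G (hsub b hb)).toHom
  have hwalk : ∀ b b' : s, (H.induce s).Walk b b' → ∀ x (hx : x ∈ f b) y (hy : y ∈ f b'),
      (G.induce (⋃ b ∈ s, f b)).Reachable ⟨x, hsub b b.2 hx⟩ ⟨y, hsub b' b'.2 hy⟩ := by
    intro b b' w
    induction w with
    | nil => exact fun x hx y hy => hlocal _ (Subtype.property _) x hx y hy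
    | @cons b c d hbc _ ih =>
      intro x hx y hy
      obtain ⟨u, hu, v, hv, huv⟩ := hadj b c hbc
      refine (hlocal b b.2 x hx u hu).trans (SimpleGraph.Reachable.trans ?_ (ih v hv y hy))
      exact SimpleGraph.Adj.reachable
        (show (G.induce (⋃ b ∈ s, f b)).Adj ⟨u, hsub b b.2 hu⟩ ⟨v, hsub c c.2 hv⟩ from huv)
  obtain ⟨b⟩ := hs.nonempty
  obtain ⟨x, hx⟩ := (hconn b).nonempty
  rw [SimpleGraph.connected_iff_exists_forall_reachable]
  refine ⟨⟨x, hsub b b.2 hx⟩, ?_⟩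
  rintro ⟨y, hy⟩
  obtain ⟨b', hb', hy'⟩ := Set.mem_iUnion₂.mp hy
  obtain ⟨w⟩ := hs.preconnected b ⟨b', hb'⟩
  exact hwalk b ⟨b', hb'⟩ w x hx y hy'

theorem SimpleGraph.IsMinorOf.trans {α β γ : Type*} {K : SimpleGraph γ} {H : SimpleGraph β}
    {G : SimpleGraph α} (hKH : K.IsMinorOf H) (hHG : H.IsMinorOf G) : K.IsMinorOf G := by
  obtain ⟨g, hgne, hgd, hgc, hga⟩ := hKH
  obtain ⟨f, hfne, hfd, hfc, hfa⟩ := hHG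
  refine ⟨fun c => ⋃ b ∈ g c, f b, fun c => ?_, fun c c' hcc' => ?_, fun c => ?_,
    fun c c' hcc' => ?_⟩
  · obtain ⟨b, hb⟩ := hgne c
    obtain ⟨x, hx⟩ := hfne b
    exact ⟨x, Set.mem_iUnion₂.mpr ⟨b, hb, hx⟩⟩
  · simp only [Set.disjoint_iUnion_left, Set.disjoint_iUnion_right]
    intro b hb b' hb'
    refine hfd _ _ ?_
    rintro rfl
    exact Set.disjoint_left.mp (hgd c c' hcc') hb' hb
  · exact SimpleGraph.connected_induce_biUnion hfc hfa (hgc c)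
  · obtain ⟨b, hb, b', hb', hbb'⟩ := hga c c' hcc'
    obtain ⟨u, hu, v, hv, huv⟩ := hfa b b' hbb'
    exact ⟨u, Set.mem_iUnion₂.mpr ⟨b, hb, hu⟩, v, Set.mem_iUnion₂.mpr ⟨b', hb', hv⟩, huv⟩

/-- Linear bound on the edges of a `K₅`-minor-free graph. -/
theorem SimpleGraph.ncard_edgeSet_le {α : Type*} [Fintype α] (G : SimpleGraph α)
    (hG : ¬ (completeGraph (Fin 5)).IsMinorOf G) : G.edgeSet.ncard ≤ 128 * Fintype.card α := by
  classical
  rw [Set.ncard_eq_toFinset_card', ← Finset.card_univ]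
  have hinj : Function.Injective (Sym2.toFinset : Sym2 α → Finset α) := by
    intro e e' h
    refine Sym2.ext fun x => ?_
    rw [← Sym2.mem_toFinset, h, Sym2.mem_toFinset]
  rw [← Finset.card_image_of_injective _ hinj]
  refine G.card_cliques_le hG Finset.univ _ fun T hT => ?_
  obtain ⟨e, he, rfl⟩ := Finset.mem_image.mp hT
  refine ⟨Finset.subset_univ _, ?_⟩
  induction e using Sym2.ind with
  | _ x y =>
    have hxy : G.Adj x y := by simpa using he
    refine ⟨⟨x, by simp⟩, ?_⟩
    intro a ha b hb hab
    rw [Finset.mem_coe, Sym2.mem_toFinset, Sym2.mem_iff] at ha hb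
    rcases ha with rfl | rfl <;> rcases hb with rfl | rfl
    · exact (hab rfl).elim
    · exact hxy
    · exact hxy.symm
    · exact (hab rfl).elim

/-- Greedily assigning to the elements `s` of `T` distinct pairs from `N s`, until for each
unassigned element every pair in `N s` is already taken. -/
theorem exists_greedy_pairs {α : Type*} [DecidableEq α] (N : α → Set α) (T : Finset α) :
    ∃ A ⊆ T, ∃ p : α → α × α,
      (∀ a ∈ A, (p a).1 ∈ N a ∧ (p a).2 ∈ N a ∧ (p a).1 ≠ (p a).2) ∧
      (∀ a ∈ A, ∀ b ∈ A, s((p a).1, (p a).2) = s((p b).1, (p b).2) → a = b) ∧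
      ∀ t ∈ T, t ∉ A → ∀ x ∈ N t, ∀ y ∈ N t, x ≠ y → ∃ a ∈ A, s((p a).1, (p a).2) = s(x, y) := by
  induction T using Finset.induction_on with
  | empty => exact ⟨∅, by simp, fun a => (a, a), by simp⟩
  | insert s T hs ih =>
    obtain ⟨A, hAT, p, hp, hinj, hcov⟩ := ih
    by_cases h : ∃ x ∈ N s, ∃ y ∈ N s, x ≠ y ∧ ∀ a ∈ A, s((p a).1, (p a).2) ≠ s(x, y)
    · obtain ⟨x, hx, y, hy, hxy, hnew⟩ := h
      have hsA : s ∉ A := fun h => hs (hAT h)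
      have hpA : ∀ a ∈ A, Function.update p s (x, y) a = p a := fun a ha =>
        Function.update_of_ne (ne_of_mem_of_not_mem ha hsA) _ _
      refine ⟨insert s A, Finset.insert_subset_insert s hAT, Function.update p s (x, y),
        ?_, ?_, ?_⟩
      · intro a ha
        rcases Finset.mem_insert.mp ha with rfl | ha
        · simpa using ⟨hx, hy, hxy⟩
        · rw [hpA a ha]
          exact hp a ha
      · intro a ha b hb hab
        rcases Finset.mem_insert.mp ha with ha | ha <;>
          rcases Finset.mem_insert.mp hb with hb | hb
        · exact ha.trans hb.symm
        · rw [ha, hpA b hb, Function.update_self] at hab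
          exact (hnew b hb hab.symm).elim
        · rw [hb, hpA a ha, Function.update_self] at hab
          exact (hnew a ha hab).elim
        · rw [hpA a ha, hpA b hb] at hab
          exact hinj a ha b hb hab
      · intro t ht htA u hu v hv huv
        rw [Finset.mem_insert, not_or] at htA
        obtain ⟨a, ha, h⟩ := hcov t (Finset.mem_of_mem_insert_of_ne ht htA.1) htA.2 u hu v hv huv
        exact ⟨a, Finset.mem_insert_of_mem ha, by rwa [hpA a ha]⟩
    · push Not at h
      refine ⟨A, hAT.trans (Finset.subset_insert s T), p, hp, hinj, ?_⟩
      intro t ht htA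
      rcases Finset.mem_insert.mp ht with rfl | ht
      · exact h
      · exact hcov t ht htA

open Finset in
/-- In a `K₅`-minor-free graph, a set of vertices whose complement is independent and has
pairwise distinct neighborhoods makes up a constant fraction of the graph. -/
theorem SimpleGraph.card_le_of_independent_compl {α : Type*} [Fintype α]
    (F : SimpleGraph α) (hF : ¬ (completeGraph (Fin 5)).IsMinorOf F) (B : Finset α)
    (hind : ∀ u v, F.Adj u v → u ∉ B → v ∈ B)
    (hinj : ∀ u v, u ∉ B → v ∉ B → F.neighborSet u = F.neighborSet v → u = v) :
    Fintype.card α ≤ 257 * #B + 1 := by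
  classical
  obtain ⟨A, hAB, p, hp, hpinj, hcov⟩ :=
    exists_greedy_pairs F.neighborSet Bᶜ
  have hA : ∀ a ∈ A, a ∉ B := fun a ha => Finset.mem_compl.mp (hAB ha)
  have hpB : ∀ a ∈ A, (p a).1 ∈ B := fun a ha => hind a _ (hp a ha).1 (hA a ha)
  let H : SimpleGraph B :=
    { Adj := fun x y => ∃ a ∈ A, s((p a).1, (p a).2) = s(x.1, y.1)
      symm := ⟨fun x y ⟨a, ha, h⟩ => ⟨a, ha, h.trans Sym2.eq_swap⟩⟩
      loopless := ⟨fun x ⟨a, ha, h⟩ => (hp a ha).2.2 <| by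
        rcases Sym2.eq_iff.mp h with ⟨h1, h2⟩ | ⟨h1, h2⟩ <;> exact h1.trans h2.symm⟩ }
  have hHF : H.IsMinorOf F := by
    let f : B → Set α := fun b => {x | x = b ∨ x ∈ A ∧ (p x).1 = b}
    have hfc : ∀ a ∈ A, ∀ b : B, (p a).1 = b → a ∈ f b := fun a ha b hb => Or.inr ⟨ha, hb⟩
    refine ⟨f, fun b => ⟨b, Or.inl rfl⟩, fun b b' hbb' => ?_, fun b => ?_, fun b b' hbb' => ?_⟩
    · rw [Set.disjoint_left]
      rintro x (rfl | ⟨hxA, hx⟩) (hx' | ⟨hxA', hx'⟩)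
      · exact hbb' (Subtype.ext hx')
      · exact hA _ hxA' b.2
      · exact hA _ hxA (hx' ▸ b'.2)
      · exact hbb' (Subtype.ext (hx.symm.trans hx'))
    · rw [SimpleGraph.connected_iff_exists_forall_reachable]
      refine ⟨⟨b, Or.inl rfl⟩, ?_⟩
      rintro ⟨x, rfl | ⟨hxA, hx⟩⟩
      · exact SimpleGraph.Reachable.refl _
      · exact SimpleGraph.Adj.reachable (show F.Adj b x from hx ▸ (hp x hxA).1.symm)
    · obtain ⟨a, ha, h⟩ := hbb'
      rcases Sym2.eq_iff.mp h with ⟨h1, h2⟩ | ⟨h1, h2⟩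
      · exact ⟨a, hfc a ha _ h1, b', Or.inl rfl, h2 ▸ (hp a ha).2.1⟩
      · exact ⟨b, Or.inl rfl, a, hfc a ha _ h1, (h2 ▸ (hp a ha).2.1 : F.Adj a b).symm⟩
  have hH : ¬ (completeGraph (Fin 5)).IsMinorOf H := fun h => hF (h.trans hHF)
  have hpB' : ∀ a ∈ A, (p a).2 ∈ B := fun a ha => hind a _ (hp a ha).2.1 (hA a ha)
  have hcardA : #A ≤ 128 * #B := by
    rw [← Fintype.card_coe B, ← Fintype.card_coe A, ← Nat.card_eq_fintype_card (α := A)]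
    refine le_trans ?_ (H.ncard_edgeSet_le hH)
    let e : A → H.edgeSet := fun a =>
      ⟨s(⟨(p a).1, hpB a a.2⟩, ⟨(p a).2, hpB' a a.2⟩), a, a.2, rfl⟩
    refine Nat.card_le_card_of_injective e fun a b hab => Subtype.ext (hpinj a a.2 b b.2 ?_)
    exact congrArg (Sym2.map Subtype.val) (congrArg Subtype.val hab)
  have hcardC : #(Bᶜ \ A) ≤ 128 * #B + 1 := by
    let N : α → Finset B := fun s => {x : B | F.Adj s x}
    have hN : Set.InjOn N (Bᶜ \ A : Finset α) := by
      intro u hu v hv huv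
      simp only [Finset.coe_sdiff, Finset.coe_compl, Set.mem_sdiff, Set.mem_compl_iff,
        Finset.mem_coe] at hu hv
      refine hinj u v hu.1 hv.1 (Set.ext fun w => ?_)
      by_cases hw : w ∈ B
      · simpa [N] using Finset.ext_iff.mp huv ⟨w, hw⟩
      · exact iff_of_false (fun h => hw (hind u w h hu.1)) (fun h => hw (hind v w h hv.1))
    rw [← Finset.card_image_of_injOn hN]
    refine le_trans (Nat.sub_le_iff_le_add.mp Finset.pred_card_le_card_erase)
      (Nat.add_le_add_right (n := #(((Bᶜ \ A).image N).erase ∅)) ?_ 1)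
    rw [← Fintype.card_coe B, ← Finset.card_univ]
    refine H.card_cliques_le hH Finset.univ _ fun T hT => ?_
    obtain ⟨hTne, hT⟩ := Finset.mem_erase.mp hT
    obtain ⟨s, hs, rfl⟩ := Finset.mem_image.mp hT
    obtain ⟨hsB, hsA⟩ := Finset.mem_sdiff.mp hs
    refine ⟨Finset.subset_univ _, Finset.nonempty_iff_ne_empty.mpr hTne, ?_⟩
    intro x hx y hy hxy
    exact hcov s hsB hsA x (by simpa [N] using hx) y (by simpa [N] using hy)
      fun h => hxy (Subtype.ext h)
  have h1 := Finset.card_add_card_compl B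
  have h2 := Finset.card_sdiff_add_card_eq_card hAB
  omega

section SMM

variable {V ι : Type*} {G : SimpleGraph V} {P : Set (Set V)} {k : ℕ} {F : SimpleGraph ι}
  {𝒞 : ι → Set (Set V)}

theorem CloudAdj.symm {p q : Set V} (h : CloudAdj G p q) : CloudAdj G q p := by
  obtain ⟨hne, u, hu, v, hv, huv⟩ := h
  exact ⟨hne.symm, v, hv, u, hu, huv.symm⟩

theorem IsSMM.cloudAdj_of_mem (hF : IsSMM G P k F 𝒞) {u : ι} {p q r : Set V} (hp : p ∈ 𝒞 u)
    (hq : q ∈ 𝒞 u) (hr : r ∈ P) (h : CloudAdj G p r) : CloudAdj G q r := by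
  have : r ∈ {r | r ∈ P ∧ CloudAdj G p r} := ⟨hr, h⟩
  rw [hF.same_nbrs u p hp q hq] at this
  exact this.2

/-- Nodes of the structure-maintaining minor are adjacent iff any representatives are. -/
theorem IsSMM.adj_iff (hF : IsSMM G P k F 𝒞) {u v : ι} {p q : Set V} (hp : p ∈ 𝒞 u)
    (hq : q ∈ 𝒞 v) : F.Adj u v ↔ CloudAdj G p q := by
  rw [hF.adj]
  constructor
  · rintro ⟨-, p', hp', q', hq', h⟩
    have h1 := hF.cloudAdj_of_mem hp' hp (hF.subset v hq') h
    exact (hF.cloudAdj_of_mem hq' hq (hF.subset u hp) h1.symm).symm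
  · refine fun h => ⟨?_, p, hp, q, hq, h⟩
    rintro rfl
    exact (hF.cloudAdj_of_mem hp hq (hF.subset u hq) h).1 rfl

theorem IsSMM.isMinorOf (hP : IsCloudPartition G P k) (hF : IsSMM G P k F 𝒞) :
    F.IsMinorOf G := by
  choose f hf using hF.nonempty
  have hfP : ∀ u, f u ∈ P := fun u => hF.subset u (hf u)
  refine ⟨f, fun u => hP.nonempty _ (hfP u), fun u v huv => ?_, fun u => hP.connected _ (hfP u),
    fun u v huv => ((hF.adj_iff (hf u) (hf v)).mp huv).2⟩
  refine hP.disjoint _ (hfP u) _ (hfP v) fun h => ?_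
  exact Set.disjoint_left.mp (hF.disjoint u v huv) (hf u) (h ▸ hf v)

/-- The structure-maintaining minor has at most `257 * (|V| / k) + 1` nodes, stated without
division. -/
theorem IsSMM.mul_card_le [Fintype V] [Fintype ι] (hG : G.IsPlanar)
    (hP : IsCloudPartition G P k) (hF : IsSMM G P k F 𝒞) :
    k * Fintype.card ι ≤ 257 * Fintype.card V + k := by
  classical
  choose f hf using hF.nonempty
  have hfP : ∀ u, f u ∈ P := fun u => hF.subset u (hf u)
  have hfd : ∀ u v, u ≠ v → Disjoint (f u) (f v) := fun u v huv =>
    hP.disjoint _ (hfP u) _ (hfP v) fun h =>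
      Set.disjoint_left.mp (hF.disjoint u v huv) (hf u) (h ▸ hf v)
  let B : Finset ι := {u | (f u).ncard = k}
  have hsmall : ∀ u, u ∉ B → (f u).ncard < k := fun u hu =>
    (hP.size _ (hfP u)).lt_of_ne (by simpa [B] using hu)
  have hF5 : ¬ (SimpleGraph.completeGraph (Fin 5)).IsMinorOf F := fun h => hG.1 (h.trans (hF.isMinorOf hP))
  have hcard : Fintype.card ι ≤ 257 * B.card + 1 := by
    refine F.card_le_of_independent_compl hF5 B (fun u v huv hu => ?_) fun u v hu hv huv => ?_
    · by_contra hv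
      exact hP.no_small_adj _ (hfP u) _ (hfP v) (hsmall u hu) (hsmall v hv)
        ((hF.adj_iff (hf u) (hf v)).mp huv)
    · refine hF.grouped u v _ (hf u) _ (hf v) (hsmall u hu) (hsmall v hv) (Set.ext fun r => ?_)
      refine and_congr_right fun hr => ?_
      obtain ⟨w, hw⟩ := hF.cover r hr
      rw [← hF.adj_iff (hf u) hw, ← hF.adj_iff (hf v) hw]
      exact Set.ext_iff.mp huv w
  have hB : k * B.card ≤ Fintype.card V := by
    have h1 : (B.biUnion fun u => (f u).toFinset).card = ∑ u ∈ B, (f u).toFinset.card :=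
      Finset.card_biUnion fun u _ v _ huv => Set.disjoint_toFinset.mpr (hfd u v huv)
    have h2 : ∑ u ∈ B, (f u).toFinset.card = B.card * k := by
      rw [← smul_eq_mul]
      refine Finset.sum_eq_card_nsmul fun u hu => ?_
      rw [← Set.ncard_eq_toFinset_card']
      exact (Finset.mem_filter.mp hu).2
    rw [mul_comm, ← h2, ← h1]
    exact Finset.card_le_univ _
  nlinarith

end SMM

/-- For a planar graph `G` on `n ≥ 2` vertices with a cloud partition `P` with clouds of
size at most `⌈c·log n⌉`, the structure-maintaining minor `F` induced by `P` has
`O(n / log n)` nodes and `O(|V(F)|)` edges. -/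
theorem smm_size_bound (c : ℝ) (hc : 0 < c) :
    ∃ C : ℝ, 0 < C ∧
      ∀ (V ι : Type) [Fintype V] [Fintype ι],
        ∀ (G : SimpleGraph V) (P : Set (Set V)) (F : SimpleGraph ι)
          (𝒞 : ι → Set (Set V)),
        G.IsPlanar → 2 ≤ Fintype.card V →
        IsCloudPartition G P ⌈c * Real.log (Fintype.card V)⌉₊ →
        IsSMM G P ⌈c * Real.log (Fintype.card V)⌉₊ F 𝒞 →
        (Fintype.card ι : ℝ) ≤ C * Fintype.card V / Real.log (Fintype.card V) ∧
        (F.edgeSet.ncard : ℝ) ≤ C * Fintype.card ι := by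
  refine ⟨257 / c + 129, by positivity, ?_⟩
  intro V ι _ _ G P F 𝒞 hG hn hP hF
  have hn2 : (2 : ℝ) ≤ Fintype.card V := by exact_mod_cast hn
  set n : ℝ := (Fintype.card V : ℝ) with hn_def
  set k := ⌈c * Real.log n⌉₊
  have hlog : 0 < Real.log n := Real.log_pos (by linarith)
  have hlogn : Real.log n ≤ n := Real.log_le_self (by linarith)
  have hk : c * Real.log n ≤ k := Nat.le_ceil _
  have hk0 : (0 : ℝ) < k := lt_of_lt_of_le (by positivity) hk
  constructor
  · have h1 : (k : ℝ) * Fintype.card ι ≤ 257 * n + k := by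
      rw [hn_def]
      exact_mod_cast hF.mul_card_le hG hP
    have h2 : (Fintype.card ι : ℝ) ≤ 257 * n / k + 1 := by
      rw [div_add_one hk0.ne', le_div_iff₀ hk0]
      linarith
    have h3 : 257 * n / k ≤ 257 * n / (c * Real.log n) := by gcongr
    have h4 : 1 ≤ n / Real.log n := (one_le_div hlog).mpr hlogn
    have h5 : (257 / c + 129) * n / Real.log n =
        257 * n / (c * Real.log n) + 129 * (n / Real.log n) := by
      field_simp
    rw [h5]
    linarith
  · have h1 : F.edgeSet.ncard ≤ 128 * Fintype.card ι :=
      F.ncard_edgeSet_le fun h => hG.1 (h.trans (hF.isMinorOf hP))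
    have h2 : (F.edgeSet.ncard : ℝ) ≤ 128 * Fintype.card ι := by exact_mod_cast h1
    refine h2.trans ?_
    gcongr
    have : 0 < 257 / c := by positivity
    linarith
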